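/- arXiv:1211.2182 — 2 statements merged into one kernel-verified Lean document; each statement's English description precedes it below -/
import Mathlib

section
/- Let q > 1, let χ be a primitive Dirichlet character mod q, let c, d be coprime positive integers, set ρ := gcd(d,q), and let α, β be complex numbers. Consider E_{α,β}(s, c/d, χ) := Σ_{n≥1} f_{α,β}(n,χ) e_d(cn) n^{−s}, absolutely convergent for Re s > 1 + max(−Re α, −Re β). Then: (i) if 1 < ρ < q there is an entire function F agreeing with this series on its half-plane of convergence; (ii) if ρ = 1 there is a function F holomorphic on ℂ∖{1−α} agreeing with the series on its half-plane of convergence and satisfying lim_{s→1−α} (s−(1−α)) F(s) = χ(d) L(1−α+β, χ) d^{−(1−α+β)}; (iii) if ρ = q there is a function F holomorphic on ℂ∖{1−β} agreeing with the series on its half-plane of convergence and satisfying lim_{s→1−β} (s−(1−β)) F(s) = χ̄(c) G(χ) L(1+α−β, χ̄) q^{α−β} d^{−(1+α−β)}. -/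
open Complex MeasureTheory Filter Topology

noncomputable section

/-- `e_d(c) = exp(2πi c/d)`. -/
def eC (d : ℕ) (c : ℤ) : ℂ := Complex.exp (2 * Real.pi * Complex.I * c / d)

/-- The conjugate Dirichlet character. -/
def conjChar {q : ℕ} (χ : DirichletCharacter ℂ q) : DirichletCharacter ℂ q :=
  χ.ringHomComp (starRingEnd ℂ)

/-- Gauss sum `G(χ) = Σ_{m=1}^{q} χ(m) e_q(m)` (here summed over `m < q`, which is the same). -/
def gaussC {q : ℕ} (χ : DirichletCharacter ℂ q) : ℂ :=
  ∑ m ∈ Finset.range q, χ (m : ZMod q) * eC q m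

/-- `f_{α,β}(n,χ) = Σ_{n₁n₂=n} n₁^{-α} n₂^{-β} χ(n₂)`. -/
def fab {q : ℕ} (χ : DirichletCharacter ℂ q) (α β : ℂ) (n : ℕ) : ℂ :=
  ∑ d ∈ n.divisors, ((n / d : ℕ) : ℂ) ^ (-α) * (d : ℂ) ^ (-β) * χ (d : ZMod q)

/-- `σ_{α,β}(n) = Σ_{n₁n₂=n} n₁^{-α} n₂^{-β}`. -/
def sigmaab (α β : ℂ) (n : ℕ) : ℂ :=
  ∑ d ∈ n.divisors, ((n / d : ℕ) : ℂ) ^ (-α) * (d : ℂ) ^ (-β)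

/-- the `q`-part `n(q)` of `n`. -/
def qPart (q n : ℕ) : ℕ := ∏ p ∈ n.primeFactors.filter (· ∣ q), p ^ (n.factorization p)

/-- local Euler factor quotient `B_{α,β,γ,δ,h}(s)`, with `χ₁` attached to `(α,β)` and
`χ₂` attached to `(γ,δ)` (the shifted one). -/
def Bh {q : ℕ} (χ₁ χ₂ : DirichletCharacter ℂ q) (α β γ δ : ℂ) (h : ℕ) (s : ℂ) : ℂ :=
  ∏ p ∈ h.primeFactors,
    (∑' j : ℕ, fab χ₁ α β (p ^ j) * fab χ₂ γ δ (p ^ (h.factorization p + j)) *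
        (p : ℂ) ^ (-((j : ℂ) * (1 + s)))) /
    (∑' j : ℕ, fab χ₁ α β (p ^ j) * fab χ₂ γ δ (p ^ j) * (p : ℂ) ^ (-((j : ℂ) * (1 + s))))

/-- `B_{α,β,γ,δ,h,k}(s) = B_{α,β,γ,δ,h}(s,χ̄) B_{γ,δ,α,β,k}(s,χ)`. -/
def Bfull {q : ℕ} (χ : DirichletCharacter ℂ q) (α β γ δ : ℂ) (h k : ℕ) (s : ℂ) : ℂ :=
  Bh χ (conjChar χ) α β γ δ h s * Bh (conjChar χ) χ γ δ α β k s

/-- `A_{α,β,γ,δ}(s)`. -/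
def Az {q : ℕ} [NeZero q] (χ : DirichletCharacter ℂ q) (α β γ δ : ℂ) (s : ℂ) : ℂ :=
  riemannZeta (1 + α + γ + s) * riemannZeta (1 + β + δ + s) *
    DirichletCharacter.LFunction χ (1 + β + γ + s) *
    DirichletCharacter.LFunction (conjChar χ) (1 + α + δ + s) /
    riemannZeta (2 + α + β + γ + δ + 2 * s) *
    ∏ p ∈ q.primeFactors,
      (1 - (p : ℂ) ^ (-1 - s - β - δ)) / (1 - (p : ℂ) ^ (-2 - 2 * s - α - β - γ - δ))

/-- `Z_{α,β,γ,δ,h,k}(s) = A_{α,β,γ,δ}(s) B_{α,β,γ,δ,h,k}(s)`. -/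
def Zfull {q : ℕ} [NeZero q] (χ : DirichletCharacter ℂ q) (α β γ δ : ℂ) (h k : ℕ) (s : ℂ) : ℂ :=
  Az χ α β γ δ s * Bfull χ α β γ δ h k s

/-- `A′_{α,β,γ,δ}(s,χ)`. -/
def A'z {q : ℕ} [NeZero q] (χ : DirichletCharacter ℂ q) (α β γ δ : ℂ) (s : ℂ) : ℂ :=
  DirichletCharacter.LFunction χ (1 + α + γ + s) * DirichletCharacter.LFunction χ (1 + β + δ + s) *
    DirichletCharacter.LFunction χ (1 + α + δ + s) * DirichletCharacter.LFunction χ (1 + β + γ + s) /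
    DirichletCharacter.LFunction (χ ^ 2) (2 + α + β + γ + δ + 2 * s)

/-- `B′_{α,β,γ,δ,h}(s,χ)`. -/
def B'h {q : ℕ} (χ : DirichletCharacter ℂ q) (α β γ δ : ℂ) (h : ℕ) (s : ℂ) : ℂ :=
  ∏ p ∈ h.primeFactors,
    (∑' j : ℕ, (χ (p : ZMod q)) ^ j * sigmaab α β (p ^ j) * sigmaab γ δ (p ^ (h.factorization p + j)) *
        (p : ℂ) ^ (-((j : ℂ) * (1 + s)))) /
    (∑' j : ℕ, (χ (p : ZMod q)) ^ j * sigmaab α β (p ^ j) * sigmaab γ δ (p ^ j) *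
        (p : ℂ) ^ (-((j : ℂ) * (1 + s))))

/-- `B′_{α,β,γ,δ,h,k}(s,χ) = B′_{α,β,γ,δ,h}(s,χ) B′_{γ,δ,α,β,k}(s,χ)`. -/
def B'full {q : ℕ} (χ : DirichletCharacter ℂ q) (α β γ δ : ℂ) (h k : ℕ) (s : ℂ) : ℂ :=
  B'h χ α β γ δ h s * B'h χ γ δ α β k s

/-- `Z′_{α,β,γ,δ,h,k}(s,χ) = conj(G(χ)) A′_{α,β,γ,δ}(s,χ) B′_{α,β,γ,δ,h,k}(s,χ)`. -/
def Z'full {q : ℕ} [NeZero q] (χ : DirichletCharacter ℂ q) (α β γ δ : ℂ) (h k : ℕ) (s : ℂ) : ℂ :=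
  (starRingEnd ℂ) (gaussC χ) * A'z χ α β γ δ s * B'full χ α β γ δ h k s

/-- `𝔞 = 0` if `χ(-1) = 1`, else `1`. -/
def frakA {q : ℕ} (χ : DirichletCharacter ℂ q) : ℕ := if χ (-1) = 1 then 0 else 1

/-- the Gamma-factor ratio `g_{α,β,γ,δ}(s,t)`. -/
def gfun {q : ℕ} (χ : DirichletCharacter ℂ q) (α β γ δ : ℂ) (s : ℂ) (t : ℝ) : ℂ :=
  (Complex.Gamma ((1 / 2 + α + s + Complex.I * t) / 2) *
      Complex.Gamma ((1 / 2 + β + s + Complex.I * t + (frakA χ : ℂ)) / 2) *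
      Complex.Gamma ((1 / 2 + γ + s - Complex.I * t) / 2) *
      Complex.Gamma ((1 / 2 + δ + s - Complex.I * t + (frakA χ : ℂ)) / 2)) /
    (Complex.Gamma ((1 / 2 + α + Complex.I * t) / 2) *
      Complex.Gamma ((1 / 2 + β + Complex.I * t + (frakA χ : ℂ)) / 2) *
      Complex.Gamma ((1 / 2 + γ - Complex.I * t) / 2) *
      Complex.Gamma ((1 / 2 + δ - Complex.I * t + (frakA χ : ℂ)) / 2))

/-- `X_{α,β,γ,δ,t}`. -/
def Xfun {q : ℕ} (χ : DirichletCharacter ℂ q) (α β γ δ : ℂ) (t : ℝ) : ℂ :=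
  (Real.pi : ℂ) ^ (α + β + γ + δ) * (q : ℂ) ^ (-β - δ) *
    (Complex.Gamma ((1 / 2 - α - Complex.I * t) / 2) *
      Complex.Gamma ((1 / 2 - β - Complex.I * t + (frakA χ : ℂ)) / 2) *
      Complex.Gamma ((1 / 2 - γ + Complex.I * t) / 2) *
      Complex.Gamma ((1 / 2 - δ + Complex.I * t + (frakA χ : ℂ)) / 2)) /
    (Complex.Gamma ((1 / 2 + α + Complex.I * t) / 2) *
      Complex.Gamma ((1 / 2 + β + Complex.I * t + (frakA χ : ℂ)) / 2) *
      Complex.Gamma ((1 / 2 + γ - Complex.I * t) / 2) *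
      Complex.Gamma ((1 / 2 + δ - Complex.I * t + (frakA χ : ℂ)) / 2))

/-- `V_{α,β,γ,δ,t}(x)`, as the contour integral along `Re s = 1`. -/
def Vfun {q : ℕ} (χ : DirichletCharacter ℂ q) (α β γ δ : ℂ) (G : ℂ → ℂ) (t : ℝ) (x : ℝ) : ℂ :=
  (1 / (2 * Real.pi)) *
    ∫ u : ℝ, G (1 + Complex.I * u) / (1 + Complex.I * u) *
      gfun χ α β γ δ (1 + Complex.I * u) t * (x : ℂ) ^ (-(1 + Complex.I * u))

/-- the Ramanujan sum `c_d(r)`. -/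
def cdR (d r : ℕ) : ℂ :=
  ∑ c ∈ (Finset.Icc 1 d).filter (fun c => Nat.gcd c d = 1), eC d (c * r)

/-- the twisted Ramanujan-type sum `c_d(r,χ) = Σ_{(c,d)=1} χ(c) e_d(-cr)`. -/
def cdChi {q : ℕ} (χ : DirichletCharacter ℂ q) (d r : ℕ) : ℂ :=
  ∑ c ∈ (Finset.Icc 1 d).filter (fun c => Nat.gcd c d = 1),
    χ (c : ZMod q) * eC d (-((c : ℤ) * r))

/-- `σ_{α,β}(n, a/d, χ)`. -/
def sigmaE {q : ℕ} (χ : DirichletCharacter ℂ q) (α β : ℂ) (d : ℕ) (a : ℤ) (n : ℕ) : ℂ :=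
  ∑ u ∈ n.divisors, (u : ℂ) ^ (-α) * ((n / u : ℕ) : ℂ) ^ (-β) *
    ∑ b ∈ Finset.Icc 1 (Nat.lcm d q),
      if ((b : ℕ) : ZMod d) = ((a * u : ℤ) : ZMod d)
      then χ (b : ZMod q) * eC (Nat.lcm d q) b else 0

/-- local factor `C_{11,α,β,γ,δ,h}(s,ψ)`. -/
def C11h {q : ℕ} (ψ : DirichletCharacter ℂ q) (α β γ δ : ℂ) (h : ℕ) (s : ℂ) : ℂ :=
  ∏ p ∈ h.primeFactors.filter (fun p => ¬ p ∣ q),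
    (let m : ℕ := h.factorization p
     ((1 - ψ (p : ZMod q) ^ (m + 1) * (p : ℂ) ^ (-(((m : ℂ) + 1) * (α + δ + 2 * s))))
      - (p : ℂ) ^ (-1 : ℂ) *
        ((ψ (p : ZMod q) * (p : ℂ) ^ (γ - δ) + (p : ℂ) ^ (-β - δ - 2 * s)) *
          (1 - ψ (p : ZMod q) ^ m * (p : ℂ) ^ (-((m : ℂ) * (α + δ + 2 * s)))))
      + (p : ℂ) ^ (-2 : ℂ) *
        (ψ (p : ZMod q) * (p : ℂ) ^ (-β + γ - 2 * δ - 2 * s)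
          - ψ (p : ZMod q) ^ m * (p : ℂ) ^ (-((m : ℂ) * (α + δ + 2 * s))) * (p : ℂ) ^ (α - β + γ - δ))) /
     ((1 - ψ (p : ZMod q) * (p : ℂ) ^ (-α - δ - 2 * s)) * (1 - (p : ℂ) ^ (-2 + α - β + γ - δ))))

/-- `C_{11,α,β,γ,δ,h,k}(s)`. -/
def C11full {q : ℕ} (χ : DirichletCharacter ℂ q) (α β γ δ : ℂ) (h k : ℕ) (s : ℂ) : ℂ :=
  C11h (conjChar χ) α β γ δ h s * C11h χ γ δ α β k s

/-- local factor `C_{22,α,β,γ,δ,h}(s,ψ)`. -/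
def C22h {q : ℕ} (ψ : DirichletCharacter ℂ q) (α β γ δ : ℂ) (h : ℕ) (s : ℂ) : ℂ :=
  ∏ p ∈ h.primeFactors.filter (fun p => ¬ p ∣ q),
    (let m : ℕ := h.factorization p
     (((p : ℂ) ^ (-((m : ℂ) * (β + γ + 2 * s))) - ψ (p : ZMod q) ^ (m + 1) * (p : ℂ) ^ (β + γ + 2 * s))
      - (p : ℂ) ^ (-1 : ℂ) *
        (((p : ℂ) ^ (-((m : ℂ) * (β + γ + 2 * s))) - ψ (p : ZMod q) ^ m) *
          ((p : ℂ) ^ (β + δ + 2 * s) + ψ (p : ZMod q) * (p : ℂ) ^ (-α + β)))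
      + (p : ℂ) ^ (-2 : ℂ) *
        ((p : ℂ) ^ (-((m : ℂ) * (β + γ + 2 * s))) * ψ (p : ZMod q) * (p : ℂ) ^ (-α + 2 * β + δ + 2 * s)
          - ψ (p : ZMod q) ^ m * (p : ℂ) ^ (-α + β - γ + δ))) /
     ((1 - ψ (p : ZMod q) * (p : ℂ) ^ (β + γ + 2 * s)) * (1 - (p : ℂ) ^ (-2 - α + β - γ + δ))))

/-- `C_{22,α,β,γ,δ,h,k}(s)`. -/
def C22full {q : ℕ} (χ : DirichletCharacter ℂ q) (α β γ δ : ℂ) (h k : ℕ) (s : ℂ) : ℂ :=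
  (qPart q h : ℂ) ^ (-β - γ - 2 * s) * (qPart q k : ℂ) ^ (-α - δ - 2 * s) *
    C22h (conjChar χ) α β γ δ h s * C22h χ γ δ α β k s

/-- local factor `C_{12,α,β,γ,δ,h}(s)`. -/
def C12h {q : ℕ} (χ : DirichletCharacter ℂ q) (α β γ δ : ℂ) (h : ℕ) (s : ℂ) : ℂ :=
  ∏ p ∈ h.primeFactors.filter (fun p => ¬ p ∣ q),
    (let m : ℕ := h.factorization p
     ((1 - (p : ℂ) ^ (-(((m : ℂ) + 1) * (α + γ + 2 * s))))
      - (p : ℂ) ^ (-1 : ℂ) *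
        (χ (p : ZMod q) * ((p : ℂ) ^ (δ - γ) + (p : ℂ) ^ (-β - γ - 2 * s)) *
          (1 - (p : ℂ) ^ (-((m : ℂ) * (α + γ + 2 * s)))))
      + (p : ℂ) ^ (-2 : ℂ) *
        (χ (p : ZMod q) ^ 2 * (p : ℂ) ^ (δ - β) *
          ((p : ℂ) ^ (-(2 * (γ + s))) - (p : ℂ) ^ (2 * (α + s)) * (p : ℂ) ^ (-(((m : ℂ) + 1) * (α + γ + 2 * s)))))) /
     ((1 - (p : ℂ) ^ (-α - γ - 2 * s)) * (1 - χ (p : ZMod q) ^ 2 * (p : ℂ) ^ (-2 + α - β - γ + δ))))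

/-- `C_{12,α,β,γ,δ,h,k}(s) = C_{12,α,β,γ,δ,h}(s) C_{12,δ,γ,β,α,k}(s)`. -/
def C12full {q : ℕ} (χ : DirichletCharacter ℂ q) (α β γ δ : ℂ) (h k : ℕ) (s : ℂ) : ℂ :=
  C12h χ α β γ δ h s * C12h χ δ γ β α k s

end

section DoubleSeries

variable {M : ℕ}

/-- The coefficients `Σ_{n₁n₂=n} n₁^{-α} n₂^{-β} K(n₁, n₂)` of the Dirichlet series attached to a
doubly periodic kernel `K`. -/
noncomputable def kernelCoeff (α β : ℂ) (K : ZMod M → ZMod M → ℂ) (n : ℕ) : ℂ :=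
  ∑ p ∈ n.divisorsAntidiagonal,
    (p.1 : ℂ) ^ (-α) * (p.2 : ℂ) ^ (-β) * K (p.1 : ZMod M) (p.2 : ZMod M)

lemma kernelCoeff_add (α β : ℂ) (K₁ K₂ : ZMod M → ZMod M → ℂ) :
    kernelCoeff α β (K₁ + K₂) = kernelCoeff α β K₁ + kernelCoeff α β K₂ := by
  ext n
  simp [kernelCoeff, mul_add, Finset.sum_add_distrib]

lemma kernelCoeff_sum {ι : Type*} (S : Finset ι) (α β : ℂ) (K : ι → ZMod M → ZMod M → ℂ) :
    kernelCoeff α β (∑ i ∈ S, K i) = ∑ i ∈ S, kernelCoeff α β (K i) := by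
  ext n
  simp only [kernelCoeff, Finset.sum_apply, Finset.mul_sum]
  exact Finset.sum_comm

variable [NeZero M]

lemma LSeriesHasSum_cpow_mul (Φ : ZMod M → ℂ) {α s : ℂ} (hs : 1 < (s + α).re) :
    LSeriesHasSum (fun n : ℕ => (n : ℂ) ^ (-α) * Φ n) s (ZMod.LFunction Φ (s + α)) := by
  rw [ZMod.LFunction_eq_LSeries Φ hs]
  have h := (ZMod.LSeriesSummable_of_one_lt_re Φ hs).LSeriesHasSum
  unfold LSeriesHasSum at h ⊢
  convert h using 1
  ext n
  rcases eq_or_ne n 0 with rfl | hn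
  · simp
  · have hn' : (n : ℂ) ≠ 0 := Nat.cast_ne_zero.mpr hn
    rw [LSeries.term_of_ne_zero hn, LSeries.term_of_ne_zero hn, Complex.cpow_neg,
      Complex.cpow_add _ _ hn']
    have h1 : (n : ℂ) ^ s ≠ 0 := by simp [Complex.cpow_eq_zero_iff, hn]
    have h2 : (n : ℂ) ^ α ≠ 0 := by simp [Complex.cpow_eq_zero_iff, hn]
    field_simp

lemma LSeriesHasSum_kernelCoeff_mul (Φ Ψ : ZMod M → ℂ) {α β s : ℂ} (hα : 1 < (s + α).re)
    (hβ : 1 < (s + β).re) :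
    LSeriesHasSum (kernelCoeff α β fun a b => Φ a * Ψ b) s
      (ZMod.LFunction Φ (s + α) * ZMod.LFunction Ψ (s + β)) := by
  have h := (LSeriesHasSum_cpow_mul Φ hα).convolution (LSeriesHasSum_cpow_mul Ψ hβ)
  convert h using 1
  rw [LSeries.convolution_def]
  ext n
  exact Finset.sum_congr rfl fun p _ => by ring

lemma LFunction_one_eq_riemannZeta {s : ℂ} (hs : 1 < s.re) :
    ZMod.LFunction (fun _ : ZMod M => (1 : ℂ)) s = riemannZeta s := by
  rw [ZMod.LFunction_eq_LSeries _ hs]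
  exact LSeries_one_eq_riemannZeta hs

/-- A kernel all of whose row and column sums vanish has an entire Dirichlet series. -/
lemma exists_differentiable_of_sums_eq_zero (α β : ℂ) (K : ZMod M → ZMod M → ℂ)
    (hrow : ∀ a, ∑ b, K a b = 0) (hcol : ∀ b, ∑ a, K a b = 0) :
    ∃ H : ℂ → ℂ, Differentiable ℂ H ∧ ∀ s : ℂ, 1 < (s + α).re → 1 < (s + β).re →
      LSeriesHasSum (kernelCoeff α β K) s (H s) := by
  have hM : (M : ℂ) ≠ 0 := Nat.cast_ne_zero.mpr (NeZero.ne M)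
  let δ : ZMod M → ZMod M → ℂ := fun x a => (if a = x then 1 else 0) - (M : ℂ)⁻¹
  have hδ (x : ZMod M) : ∑ a, δ x a = 0 := by
    simp [δ, Finset.sum_sub_distrib, ZMod.card, hM]
  refine ⟨fun s => ∑ x, ZMod.LFunction (δ x) (s + α) * ZMod.LFunction (K x) (s + β), ?_, ?_⟩
  · refine Differentiable.fun_sum fun x _ => Differentiable.mul ?_ ?_
    · exact (ZMod.differentiable_LFunction_of_sum_zero (hδ x)).comp (by fun_prop)
    · exact (ZMod.differentiable_LFunction_of_sum_zero (hrow x)).comp (by fun_prop)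
  · intro s hα hβ
    have hK : K = ∑ x, fun a b => δ x a * K x b := by
      ext a b
      simp [δ, Finset.sum_apply, sub_mul, Finset.sum_sub_distrib, ← Finset.mul_sum, hcol]
    have h := LSeriesHasSum.sum (S := Finset.univ)
      fun x _ => LSeriesHasSum_kernelCoeff_mul (δ x) (K x) hα hβ
    rwa [← kernelCoeff_sum, ← hK] at h

/-- The Dirichlet series of a kernel of total mass zero is entire up to the contributions of its
column and row averages. -/
lemma exists_differentiable_add_riemannZeta (α β : ℂ) (K : ZMod M → ZMod M → ℂ)
    (hK : ∑ a, ∑ b, K a b = 0) :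
    ∃ H : ℂ → ℂ, Differentiable ℂ H ∧ ∀ s : ℂ, 1 < (s + α).re → 1 < (s + β).re →
      LSeriesHasSum (kernelCoeff α β K) s (H s +
        riemannZeta (s + α) * ZMod.LFunction (fun b => (M : ℂ)⁻¹ * ∑ a, K a b) (s + β) +
        ZMod.LFunction (fun a => (M : ℂ)⁻¹ * ∑ b, K a b) (s + α) * riemannZeta (s + β)) := by
  have hM : (M : ℂ) ≠ 0 := Nat.cast_ne_zero.mpr (NeZero.ne M)
  have hK' : ∑ b, ∑ a, K a b = 0 := by rw [Finset.sum_comm]; exact hK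
  set r : ZMod M → ℂ := fun b => (M : ℂ)⁻¹ * ∑ a, K a b with hr
  set m : ZMod M → ℂ := fun a => (M : ℂ)⁻¹ * ∑ b, K a b with hm
  obtain ⟨H, hH, hsum⟩ := exists_differentiable_of_sums_eq_zero α β
    (fun a b => K a b - r b - m a)
    (fun a => by simp [Finset.sum_sub_distrib, hr, hm, ← Finset.mul_sum, hK', ZMod.card, hM])
    (fun b => by simp [Finset.sum_sub_distrib, hr, hm, ← Finset.mul_sum, hK, ZMod.card, hM])
  refine ⟨H, hH, fun s hα hβ => ?_⟩
  have h := ((hsum s hα hβ).add (LSeriesHasSum_kernelCoeff_mul (fun _ => 1) r hα hβ)).add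
    (LSeriesHasSum_kernelCoeff_mul m (fun _ => 1) hα hβ)
  rw [← kernelCoeff_add, ← kernelCoeff_add, LFunction_one_eq_riemannZeta hα,
    LFunction_one_eq_riemannZeta hβ] at h
  convert h using 2
  ext a b
  simp only [Pi.add_apply]
  ring

/-- The `L`-function of a function supported on the multiples of `D`, where it is proportional to
`Φ(·/D)`. -/
lemma LFunction_eq_of_supported_on_multiples {N D : ℕ} [NeZero N] (hD : 0 < D) (κ : ℂ)
    (Φ : ZMod N → ℂ) (Ψ : ZMod M → ℂ) (hmul : ∀ k : ℕ, Ψ ((D * k : ℕ) : ZMod M) = κ * Φ k)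
    (hzero : ∀ n : ℕ, ¬ D ∣ n → Ψ n = 0) {s : ℂ} (hs : 1 < s.re) :
    ZMod.LFunction Ψ s = κ * (D : ℂ) ^ (-s) * ZMod.LFunction Φ s := by
  rw [ZMod.LFunction_eq_LSeries Ψ hs, ZMod.LFunction_eq_LSeries Φ hs, LSeries, LSeries,
    ← tsum_mul_left]
  have hinj : Function.Injective fun k : ℕ => D * k := mul_right_injective₀ hD.ne'
  rw [← hinj.tsum_eq]
  · refine tsum_congr fun k => ?_
    rcases eq_or_ne k 0 with rfl | hk
    · simp
    · rw [LSeries.term_of_ne_zero (mul_ne_zero hD.ne' hk), LSeries.term_of_ne_zero hk, hmul,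
        Nat.cast_mul, Complex.natCast_mul_natCast_cpow, Complex.cpow_neg]
      field_simp
  · intro n hn
    by_contra hcon
    refine hn ?_
    have hdvd : ¬ D ∣ n := fun ⟨k, hk⟩ => hcon ⟨k, hk.symm⟩
    rw [LSeries.term_def, hzero n hdvd]
    simp

end DoubleSeries

section Kernel

lemma ZMod.sum_comp_castHom {N M : ℕ} [NeZero N] [NeZero M] (h : N ∣ M) (f : ZMod N → ℂ) :
    (M : ℂ)⁻¹ * ∑ x : ZMod M, f (ZMod.castHom h (ZMod N) x) = (N : ℂ)⁻¹ * ∑ y, f y := by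
  have hsurj : Function.Surjective (ZMod.castHom h (ZMod N)) := ZMod.castHom_surjective h
  let k : ℕ := (Finset.univ.filter fun x : ZMod M => ZMod.castHom h (ZMod N) x = 0).card
  have hfib (y : ZMod N) :
      (Finset.univ.filter fun x : ZMod M => ZMod.castHom h (ZMod N) x = y).card = k :=
    AddMonoidHom.card_fiber_eq_of_mem_range (ZMod.castHom h (ZMod N)) (hsurj y) (hsurj 0)
  have key (g : ZMod N → ℂ) :
      ∑ x : ZMod M, g (ZMod.castHom h (ZMod N) x) = k * ∑ y, g y := by
    rw [← Finset.sum_fiberwise Finset.univ (ZMod.castHom h (ZMod N)), Finset.mul_sum]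
    refine Finset.sum_congr rfl fun y _ => ?_
    rw [Finset.sum_congr rfl (g := fun _ => g y) fun x hx => by rw [(Finset.mem_filter.mp hx).2]]
    rw [Finset.sum_const, hfib, nsmul_eq_mul]
  have hcard : (M : ℂ) = k * N := by simpa [ZMod.card] using key fun _ => 1
  have hM : (M : ℂ) ≠ 0 := Nat.cast_ne_zero.mpr (NeZero.ne M)
  have hN : (N : ℂ) ≠ 0 := Nat.cast_ne_zero.mpr (NeZero.ne N)
  rw [key, hcard]
  have hk : (k : ℂ) ≠ 0 := fun hk => hM (by rw [hcard, hk, zero_mul])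
  field_simp

lemma eC_eq_stdAddChar (d : ℕ) [NeZero d] (j : ℤ) : eC d j = ZMod.stdAddChar (j : ZMod d) := by
  rw [ZMod.stdAddChar_coe, eC]

lemma gaussC_eq_gaussSum {q : ℕ} [NeZero q] (χ : DirichletCharacter ℂ q) :
    gaussC χ = gaussSum χ ZMod.stdAddChar := by
  rw [gaussC, gaussSum]
  refine Finset.sum_bij' (fun m _ => (m : ZMod q)) (fun x _ => x.val) (by simp)
    (fun x _ => Finset.mem_range.mpr x.val_lt)
    (fun m hm => ZMod.val_cast_of_lt (Finset.mem_range.mp hm)) (by simp) fun m _ => ?_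
  rw [eC_eq_stdAddChar, Int.cast_natCast]

lemma conjChar_eq_inv {q : ℕ} (χ : DirichletCharacter ℂ q) : conjChar χ = χ⁻¹ := by
  rw [← MulChar.star_eq_inv]
  rfl

variable {q d : ℕ} [NeZero d]

/-- The kernel `(a, b) ↦ χ(b) e_d(cab)`, as a function on residues modulo `dq`. -/
noncomputable def charKernel (χ : DirichletCharacter ℂ q) (c d : ℕ) [NeZero d]
    (a b : ZMod (d * q)) : ℂ :=
  χ (ZMod.castHom (Dvd.intro_left d rfl) (ZMod q) b) *
    ZMod.stdAddChar ((c : ZMod d) * ZMod.castHom (Dvd.intro q rfl) (ZMod d) a *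
      ZMod.castHom (Dvd.intro q rfl) (ZMod d) b)

lemma fab_mul_eC_eq_kernelCoeff (χ : DirichletCharacter ℂ q) (c : ℕ) (α β : ℂ) (n : ℕ) :
    fab χ α β n * eC d ((c : ℤ) * n) = kernelCoeff α β (charKernel χ c d) n := by
  rw [fab, kernelCoeff, Nat.sum_divisorsAntidiagonal'
    (f := fun x y => (x : ℂ) ^ (-α) * (y : ℂ) ^ (-β) * charKernel χ c d x y), Finset.sum_mul]
  refine Finset.sum_congr rfl fun y hy => ?_
  have hn : ((n / y : ℕ) : ZMod d) * (y : ZMod d) = n := by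
    rw [← Nat.cast_mul, Nat.div_mul_cancel (Nat.dvd_of_mem_divisors hy)]
  simp only [charKernel, map_natCast, mul_assoc, hn, eC_eq_stdAddChar]
  push_cast
  rfl

variable [NeZero q]

/-- The substitution `(a, b) ↦ (u⁻¹a, ub)` multiplies the kernel by `χ(u)`. -/
lemma sum_charKernel {χ : DirichletCharacter ℂ q} (hχ : χ ≠ 1) (c : ℕ) :
    ∑ a, ∑ b, charKernel χ c d a b = 0 := by
  obtain ⟨v, hv⟩ := MulChar.ne_one_iff.mp hχ
  obtain ⟨u, rfl⟩ := ZMod.unitsMap_surjective (Dvd.intro_left d rfl : q ∣ d * q) v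
  have huv (a b : ZMod (d * q)) : charKernel χ c d (↑u⁻¹ * a) (↑u * b) =
      χ (ZMod.unitsMap (Dvd.intro_left d rfl : q ∣ d * q) u) * charKernel χ c d a b := by
    have hu : ZMod.castHom (Dvd.intro q rfl) (ZMod d) (↑u⁻¹ : ZMod (d * q)) *
        ZMod.castHom (Dvd.intro q rfl) (ZMod d) (u : ZMod (d * q)) = 1 := by
      rw [← map_mul, Units.inv_mul, map_one]
    simp only [charKernel, map_mul]
    rw [show ∀ x y z w t : ZMod d, t * (x * y) * (z * w) = (x * z) * (t * y * w) by
      intros; ring, hu, one_mul, mul_assoc]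
    rfl
  have h : ∑ a, ∑ b, charKernel χ c d a b =
      χ (ZMod.unitsMap (Dvd.intro_left d rfl : q ∣ d * q) u) *
        ∑ a, ∑ b, charKernel χ c d a b := by
    simp only [Finset.mul_sum, ← huv]
    refine (Fintype.sum_equiv (Units.mulLeft u⁻¹) _ _ fun a => ?_).symm
    exact Fintype.sum_equiv (Units.mulLeft u) _ _ fun b => rfl
  by_contra hne
  exact hv (mul_right_cancel₀ hne (by rw [one_mul]; exact h.symm))

lemma avg_charKernel_left (χ : DirichletCharacter ℂ q) {c : ℕ} (hcd : Nat.Coprime c d) (n : ℕ) :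
    ((d * q : ℕ) : ℂ)⁻¹ * ∑ a, charKernel χ c d a n = if d ∣ n then χ n else 0 := by
  have hd : (d : ℂ) ≠ 0 := Nat.cast_ne_zero.mpr (NeZero.ne d)
  simp only [charKernel, map_natCast]
  rw [ZMod.sum_comp_castHom (Dvd.intro q rfl)
    fun y : ZMod d => χ (n : ZMod q) * ZMod.stdAddChar (c * y * n : ZMod d), ← Finset.mul_sum]
  have h := AddChar.sum_mulShift (R := ZMod d) ((c * n : ℕ) : ZMod d)
    (ZMod.isPrimitive_stdAddChar d)
  rw [Finset.sum_congr rfl (g := fun y : ZMod d => ZMod.stdAddChar (y * ((c * n : ℕ) : ZMod d)))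
    fun y _ => by congr 1; push_cast; ring, h]
  have hiff : ((c * n : ℕ) : ZMod d) = 0 ↔ d ∣ n := by
    rw [ZMod.natCast_eq_zero_iff]
    exact hcd.symm.dvd_mul_left
  simp only [hiff, ZMod.card]
  split_ifs
  · field_simp
  · simp

lemma stdAddChar_mul_div_gcd (x : ℕ) :
    ZMod.stdAddChar ((d / d.gcd q * x : ℕ) : ZMod d) =
      ZMod.stdAddChar ((q / d.gcd q * x : ℕ) : ZMod q) := by
  have hd : (d : ℂ) ≠ 0 := Nat.cast_ne_zero.mpr (NeZero.ne d)
  have hq : (q : ℂ) ≠ 0 := Nat.cast_ne_zero.mpr (NeZero.ne q)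
  have hg : ((d.gcd q : ℕ) : ℂ) ≠ 0 :=
    Nat.cast_ne_zero.mpr (Nat.gcd_pos_of_pos_left q (NeZero.pos d)).ne'
  have h1 := ZMod.stdAddChar_coe (N := d) ((d / d.gcd q * x : ℕ) : ℤ)
  have h2 := ZMod.stdAddChar_coe (N := q) ((q / d.gcd q * x : ℕ) : ℤ)
  rw [Int.cast_natCast] at h1 h2
  rw [h1, h2]
  congr 1
  rw [Int.cast_natCast, Int.cast_natCast, Nat.cast_mul, Nat.cast_mul,
    Nat.cast_div (Nat.gcd_dvd_left d q) hg, Nat.cast_div (Nat.gcd_dvd_right d q) hg]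
  field_simp

lemma avg_charKernel_right_of_dvd {χ : DirichletCharacter ℂ q} (hχ : χ.IsPrimitive) (c k : ℕ) :
    ((d * q : ℕ) : ℂ)⁻¹ * ∑ b, charKernel χ c d ((d / d.gcd q * k : ℕ) : ZMod (d * q)) b =
      (q : ℂ)⁻¹ * gaussC χ * χ⁻¹ (c : ZMod q) * χ⁻¹ ((q / d.gcd q : ℕ) : ZMod q) *
        χ⁻¹ (k : ZMod q) := by
  have hker (b : ZMod (d * q)) :
      charKernel χ c d ((d / d.gcd q * k : ℕ) : ZMod (d * q)) b =
        (fun y : ZMod q => χ y * ZMod.stdAddChar (((q / d.gcd q * (c * k) : ℕ) : ZMod q) * y))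
          (ZMod.castHom (Dvd.intro_left d rfl) (ZMod q) b) := by
    obtain ⟨j, rfl⟩ := ZMod.natCast_zmod_surjective b
    have h := stdAddChar_mul_div_gcd (q := q) (d := d) (c * k * j)
    simp only [charKernel, map_natCast, ← Nat.cast_mul]
    rw [show c * (d / d.gcd q * k) * j = d / d.gcd q * (c * k * j) by ring, h,
      ← mul_assoc (q / d.gcd q) (c * k) j]
  simp only [hker]
  rw [ZMod.sum_comp_castHom (Dvd.intro_left d rfl : q ∣ d * q) fun y : ZMod q =>
    χ y * ZMod.stdAddChar (((q / d.gcd q * (c * k) : ℕ) : ZMod q) * y)]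
  have h := gaussSum_mulShift_of_isPrimitive ZMod.stdAddChar hχ
    ((q / d.gcd q * (c * k) : ℕ) : ZMod q)
  simp only [gaussSum, AddChar.mulShift_apply] at h
  rw [h, gaussC_eq_gaussSum, gaussSum]
  push_cast
  simp only [map_mul]
  ring

lemma avg_charKernel_right_of_not_dvd (χ : DirichletCharacter ℂ q) {c : ℕ}
    (hcd : Nat.Coprime c d) {n : ℕ} (hn : ¬ d / d.gcd q ∣ n) :
    ((d * q : ℕ) : ℂ)⁻¹ * ∑ b, charKernel χ c d n b = 0 := by
  have hshift (b : ZMod (d * q)) : charKernel χ c d n (b + (q : ℕ)) =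
      ZMod.stdAddChar ((c * n * q : ℕ) : ZMod d) * charKernel χ c d n b := by
    simp only [charKernel, map_add, map_natCast, ZMod.natCast_self, add_zero, mul_add,
      AddChar.map_add_eq_mul, Nat.cast_mul]
    ring
  have h : ∑ b, charKernel χ c d n b =
      ZMod.stdAddChar ((c * n * q : ℕ) : ZMod d) * ∑ b, charKernel χ c d n b := by
    simp only [Finset.mul_sum, ← hshift]
    exact (Fintype.sum_equiv (Equiv.addRight ((q : ℕ) : ZMod (d * q))) _ _ fun b => rfl).symm
  have hne : ZMod.stdAddChar ((c * n * q : ℕ) : ZMod d) ≠ 1 := by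
    rw [← (ZMod.stdAddChar (N := d)).map_zero_eq_one, ZMod.injective_stdAddChar.ne_iff, ne_eq,
      ZMod.natCast_eq_zero_iff, mul_assoc, hcd.symm.dvd_mul_left]
    intro hdvd
    refine hn ((Nat.coprime_div_gcd_div_gcd
      (Nat.gcd_pos_of_pos_left q (NeZero.pos d))).dvd_of_dvd_mul_right ?_)
    rw [← Nat.mul_div_assoc _ (Nat.gcd_dvd_right d q)]
    exact Nat.div_dvd_div (Nat.gcd_dvd_left d q) hdvd
  by_contra hcon
  have hsum : ∑ b, charKernel χ c d n b ≠ 0 := fun h0 => hcon (by rw [h0, mul_zero])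
  exact hne (mul_right_cancel₀ hsum (by rw [one_mul]; exact h.symm))

/-- The series `Σ f_{α,β}(n,χ) e_d(cn) n^{-s}` is entire up to two explicit polar terms. -/
lemma exists_differentiable_add_polar_terms {χ : DirichletCharacter ℂ q} (hχ : χ.IsPrimitive)
    (hχ₁ : χ ≠ 1) {c : ℕ} (hcd : Nat.Coprime c d) (α β : ℂ) :
    ∃ H : ℂ → ℂ, Differentiable ℂ H ∧ ∀ s : ℂ, 1 + max (-α.re) (-β.re) < s.re →
      HasSum (fun n : ℕ+ => fab χ α β (n : ℕ) * eC d ((c : ℤ) * (n : ℕ)) * ((n : ℕ) : ℂ) ^ (-s))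
        (H s +
          riemannZeta (s + α) *
            (χ (d : ZMod q) * (d : ℂ) ^ (-(s + β)) * DirichletCharacter.LFunction χ (s + β)) +
          (q : ℂ)⁻¹ * gaussC χ * χ⁻¹ (c : ZMod q) * χ⁻¹ ((q / d.gcd q : ℕ) : ZMod q) *
            ((d / d.gcd q : ℕ) : ℂ) ^ (-(s + α)) * DirichletCharacter.LFunction χ⁻¹ (s + α) *
            riemannZeta (s + β)) := by
  obtain ⟨H, hH, hsum⟩ := exists_differentiable_add_riemannZeta α β (charKernel χ c d)
    (sum_charKernel hχ₁ c)
  refine ⟨H, hH, fun s hs => ?_⟩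
  have hα : 1 < (s + α).re := by
    rw [Complex.add_re]; linarith [le_max_left (-α.re) (-β.re)]
  have hβ : 1 < (s + β).re := by
    rw [Complex.add_re]; linarith [le_max_right (-α.re) (-β.re)]
  have h := hsum s hα hβ
  have hpos : 0 < d / d.gcd q :=
    Nat.div_pos (Nat.gcd_le_left q (NeZero.pos d)) (Nat.gcd_pos_of_pos_left q (NeZero.pos d))
  rw [LFunction_eq_of_supported_on_multiples (NeZero.pos d) (χ (d : ZMod q)) χ _
      (fun k => by rw [avg_charKernel_left χ hcd, if_pos (Dvd.intro k rfl), Nat.cast_mul, map_mul])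
      (fun n hn => by rw [avg_charKernel_left χ hcd, if_neg hn]) hβ,
    LFunction_eq_of_supported_on_multiples hpos _ (χ⁻¹ : DirichletCharacter ℂ q) _
      (fun k => avg_charKernel_right_of_dvd hχ c k)
      (fun n hn => avg_charKernel_right_of_not_dvd χ hcd hn) hα] at h
  have h' := (PNat.coe_injective.hasSum_iff fun n hn => ?_).mpr h
  · convert h' using 1
    ext n
    rw [Function.comp_apply, LSeries.term_of_ne_zero n.ne_zero, fab_mul_eC_eq_kernelCoeff,
      Complex.cpow_neg, div_eq_mul_inv]
    rfl
  · have : n = 0 := by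
      by_contra h0
      exact hn ⟨⟨n, Nat.pos_of_ne_zero h0⟩, rfl⟩
    rw [this, LSeries.term_zero]

end Kernel

section Polar

lemma differentiableOn_add_riemannZeta_mul {H g : ℂ → ℂ} (hH : Differentiable ℂ H)
    (hg : Differentiable ℂ g) (α : ℂ) :
    DifferentiableOn ℂ (fun s => H s + riemannZeta (s + α) * g s) {(1 : ℂ) - α}ᶜ := by
  intro s hs
  have hs' : s + α ≠ 1 := fun h => hs (eq_sub_of_add_eq h)
  have hζ : DifferentiableAt ℂ (fun s => riemannZeta (s + α)) s :=
    (differentiableAt_riemannZeta hs').comp s (by fun_prop)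
  exact ((hH s).add (hζ.mul (hg s))).differentiableWithinAt

lemma tendsto_sub_mul_add_riemannZeta_mul {H g : ℂ → ℂ} (hH : Differentiable ℂ H)
    (hg : Differentiable ℂ g) (α : ℂ) :
    Tendsto (fun s => (s - (1 - α)) * (H s + riemannZeta (s + α) * g s)) (𝓝[≠] (1 - α))
      (𝓝 (g (1 - α))) := by
  have hshift : Tendsto (fun s => s + α) (𝓝[≠] (1 - α)) (𝓝[≠] 1) := by
    refine tendsto_nhdsWithin_iff.mpr ⟨?_, ?_⟩
    · have h : Tendsto (fun s : ℂ => s + α) (𝓝 (1 - α)) (𝓝 (1 - α + α)) :=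
        (continuous_id.add continuous_const).tendsto _
      rw [sub_add_cancel] at h
      exact h.mono_left nhdsWithin_le_nhds
    · filter_upwards [self_mem_nhdsWithin] with s hs h
      exact hs (eq_sub_of_add_eq h)
  have hres := riemannZeta_residue_one.comp hshift
  have hH' : Tendsto H (𝓝[≠] (1 - α)) (𝓝 (H (1 - α))) :=
    (hH.continuous.tendsto _).mono_left nhdsWithin_le_nhds
  have hg' : Tendsto g (𝓝[≠] (1 - α)) (𝓝 (g (1 - α))) :=
    (hg.continuous.tendsto _).mono_left nhdsWithin_le_nhds
  have hlin : Tendsto (fun s : ℂ => s - (1 - α)) (𝓝[≠] (1 - α)) (𝓝 (1 - α - (1 - α))) :=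
    ((continuous_id.sub continuous_const).tendsto _).mono_left nhdsWithin_le_nhds
  convert (hlin.mul hH').add (hres.mul hg') using 2
  · simp only [Function.comp_apply]
    ring
  · ring

lemma DirichletCharacter.apply_natCast_eq_zero {q n : ℕ} (χ : DirichletCharacter ℂ q)
    (h : ¬ n.Coprime q) : χ (n : ZMod q) = 0 :=
  χ.map_nonunit fun hu => h ((ZMod.isUnit_iff_coprime n q).mp hu)

lemma DirichletCharacter.differentiable_cpow_mul_LFunction {q n : ℕ} [NeZero q] (hn : n ≠ 0)
    {χ : DirichletCharacter ℂ q} (hχ : χ ≠ 1) (κ β : ℂ) :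
    Differentiable ℂ fun s =>
      κ * (n : ℂ) ^ (-(s + β)) * DirichletCharacter.LFunction χ (s + β) := by
  have hn' : (n : ℂ) ≠ 0 := Nat.cast_ne_zero.mpr hn
  have hL : Differentiable ℂ fun s => DirichletCharacter.LFunction χ (s + β) :=
    (DirichletCharacter.differentiable_LFunction hχ).comp (by fun_prop)
  have hpow : Differentiable ℂ fun s : ℂ => (n : ℂ) ^ (-(s + β)) := fun s =>
    DifferentiableAt.const_cpow (by fun_prop) (Or.inl hn')
  exact (hpow.const_mul κ).mul hL

end Polar

/-- analytic continuation and residues of `E_{α,β}(s,c/d,χ)`. -/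
theorem statement_3 (q : ℕ) [NeZero q] (hq : 1 < q)
    (χ : DirichletCharacter ℂ q) (hχ : χ.IsPrimitive)
    (c d : ℕ) (hc : 0 < c) (hd : 0 < d) (hcd : Nat.Coprime c d) (α β : ℂ) :
    -- the series converges absolutely on the half-plane
    (∀ s : ℂ, 1 + max (-α.re) (-β.re) < s.re →
      Summable (fun n : ℕ+ => fab χ α β (n : ℕ) * eC d ((c : ℤ) * (n : ℕ)) *
        ((n : ℕ) : ℂ) ^ (-s))) ∧
    -- (i) if 1 < ρ < q, entire continuation
    (1 < Nat.gcd d q → Nat.gcd d q < q →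
      ∃ F : ℂ → ℂ, Differentiable ℂ F ∧
        ∀ s : ℂ, 1 + max (-α.re) (-β.re) < s.re →
          F s = ∑' n : ℕ+, fab χ α β (n : ℕ) * eC d ((c : ℤ) * (n : ℕ)) *
            ((n : ℕ) : ℂ) ^ (-s)) ∧
    -- (ii) if ρ = 1, meromorphic continuation with a simple pole at 1 - α
    (Nat.gcd d q = 1 →
      ∃ F : ℂ → ℂ, DifferentiableOn ℂ F {(1 : ℂ) - α}ᶜ ∧
        (∀ s : ℂ, 1 + max (-α.re) (-β.re) < s.re →
          F s = ∑' n : ℕ+, fab χ α β (n : ℕ) * eC d ((c : ℤ) * (n : ℕ)) *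
            ((n : ℕ) : ℂ) ^ (-s)) ∧
        Filter.Tendsto (fun s : ℂ => (s - (1 - α)) * F s) (𝓝[≠] (1 - α))
          (𝓝 (χ (d : ZMod q) * DirichletCharacter.LFunction χ (1 - α + β) *
            (d : ℂ) ^ (-(1 - α + β))))) ∧
    -- (iii) if ρ = q, meromorphic continuation with a simple pole at 1 - β
    (Nat.gcd d q = q →
      ∃ F : ℂ → ℂ, DifferentiableOn ℂ F {(1 : ℂ) - β}ᶜ ∧
        (∀ s : ℂ, 1 + max (-α.re) (-β.re) < s.re →
          F s = ∑' n : ℕ+, fab χ α β (n : ℕ) * eC d ((c : ℤ) * (n : ℕ)) *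
            ((n : ℕ) : ℂ) ^ (-s)) ∧
        Filter.Tendsto (fun s : ℂ => (s - (1 - β)) * F s) (𝓝[≠] (1 - β))
          (𝓝 (conjChar χ (c : ZMod q) * gaussC χ *
            DirichletCharacter.LFunction (conjChar χ) (1 + α - β) *
            (q : ℂ) ^ (α - β) * (d : ℂ) ^ (-(1 + α - β))))) := by
  have hχ₁ : χ ≠ 1 := by
    rintro rfl
    have h : (1 : DirichletCharacter ℂ q).conductor = q := hχ
    rw [DirichletCharacter.conductor_one] at h
    omega
  have : NeZero d := ⟨hd.ne'⟩
  have hgpos : 0 < d.gcd q := Nat.gcd_pos_of_pos_left q hd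
  have hχd (h : 1 < d.gcd q) : χ (d : ZMod q) = 0 := χ.apply_natCast_eq_zero h.ne'
  have hχq (h : d.gcd q < q) : χ⁻¹ ((q / d.gcd q : ℕ) : ZMod q) = 0 := by
    refine (χ⁻¹).apply_natCast_eq_zero fun hcop => h.ne ?_
    have h1 := Nat.Coprime.eq_one_of_dvd hcop (Nat.div_dvd_of_dvd (Nat.gcd_dvd_right d q))
    have h2 := Nat.div_mul_cancel (Nat.gcd_dvd_right d q)
    rwa [h1, one_mul] at h2
  obtain ⟨H, hH, hsum⟩ := exists_differentiable_add_polar_terms hχ hχ₁ hcd α β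
  refine ⟨fun s hs => (hsum s hs).summable, fun h1 h2 => ⟨H, hH, fun s hs => ?_⟩,
    fun h1 => ?_, fun h1 => ?_⟩
  · rw [(hsum s hs).tsum_eq, hχd h1, hχq h2]
    ring
  · have hg := DirichletCharacter.differentiable_cpow_mul_LFunction hd.ne' hχ₁ (χ (d : ZMod q)) β
    refine ⟨_, differentiableOn_add_riemannZeta_mul hH hg α, fun s hs => ?_, ?_⟩
    · rw [(hsum s hs).tsum_eq, hχq (h1 ▸ hq)]
      ring
    · convert tendsto_sub_mul_add_riemannZeta_mul hH hg α using 2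
      ring
  · have hqd : q ∣ d := h1 ▸ Nat.gcd_dvd_left d q
    have hdq : d / q ≠ 0 := (Nat.div_pos (Nat.le_of_dvd hd hqd) (NeZero.pos q)).ne'
    have hg := DirichletCharacter.differentiable_cpow_mul_LFunction hdq (inv_ne_one.mpr hχ₁)
      ((q : ℂ)⁻¹ * gaussC χ * χ⁻¹ (c : ZMod q)) α
    refine ⟨_, differentiableOn_add_riemannZeta_mul hH hg β, fun s hs => ?_, ?_⟩
    · rw [(hsum s hs).tsum_eq, hχd (h1.symm ▸ hq : 1 < d.gcd q), h1, Nat.div_self (NeZero.pos q), Nat.cast_one,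
        map_one]
      ring
    · convert tendsto_sub_mul_add_riemannZeta_mul hH hg β using 2
      have hq0 : (q : ℂ) ≠ 0 := Nat.cast_ne_zero.mpr (NeZero.ne q)
      obtain ⟨e, rfl⟩ := hqd
      have hpow : (q : ℂ) ^ (α - β) * ((q * e : ℕ) : ℂ) ^ (-(1 + α - β)) =
          (q : ℂ)⁻¹ * (e : ℂ) ^ (-(1 - β + α)) := by
        rw [Nat.cast_mul, Complex.natCast_mul_natCast_cpow, ← mul_assoc,
          ← Complex.cpow_add _ _ hq0, ← Complex.cpow_neg_one]
        congr 2 <;> ring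
      rw [Nat.mul_div_cancel_left _ (NeZero.pos q), conjChar_eq_inv, mul_assoc, hpow,
        show 1 + α - β = 1 - β + α by ring]
      ring
end

section
/- Let χ be a primitive Dirichlet character mod q, let h, k be coprime positive integers with q | h (hence gcd(k,q)=1), and let α, β, γ, δ be complex numbers with |Re α|, |Re β|, |Re γ|, |Re δ| < 1/4 such that p^{α+γ} ≠ 1 for every prime p | h with p∤q and p^{β+δ} ≠ 1 for every prime p | k. Then q^{−α} · (Σ_{m | h(q)/q} m^{−α−γ}) · h^{α} k^{δ} · C_{12,α,β,γ,δ,h,k}(0) = B′_{−δ,β,γ,−α,h/q,k}(0,χ), where B′_{α,β,γ,δ,h,k}(s,χ) := B′_{α,β,γ,δ,h}(s,χ) · B′_{γ,δ,α,β,k}(s,χ). -/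
open Complex MeasureTheory Filter Topology

/-- The complete homogeneous symmetric polynomial of degree `n` in two variables. -/
noncomputable def homogSum (x y : ℂ) (n : ℕ) : ℂ :=
  ∑ kl ∈ Finset.HasAntidiagonal.antidiagonal n, x ^ kl.1 * y ^ kl.2

lemma homogSum_comm (x y : ℂ) (n : ℕ) : homogSum x y n = homogSum y x n := by
  unfold homogSum
  rw [← Finset.Nat.sum_antidiagonal_swap]
  simp [mul_comm]

lemma homogSum_mul_sub (x y : ℂ) (n : ℕ) :
    homogSum x y n * (x - y) = x ^ (n + 1) - y ^ (n + 1) := by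
  unfold homogSum
  rw [Finset.Nat.sum_antidiagonal_eq_sum_range_succ (fun i j => x ^ i * y ^ j),
    ← geom_sum₂_mul]
  simp

lemma hasSum_homogSum_mul_pow {x y z : ℂ} (hx : ‖x * z‖ < 1) (hy : ‖y * z‖ < 1) :
    HasSum (fun n => homogSum x y n * z ^ n) ((1 - x * z)⁻¹ * (1 - y * z)⁻¹) := by
  have hxs : Summable fun n => ‖(x * z) ^ n‖ := summable_norm_geometric_of_norm_lt_one hx
  have hys : Summable fun n => ‖(y * z) ^ n‖ := summable_norm_geometric_of_norm_lt_one hy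
  have key : (fun n => homogSum x y n * z ^ n) =
      fun n => ∑ kl ∈ Finset.HasAntidiagonal.antidiagonal n, (x * z) ^ kl.1 * (y * z) ^ kl.2 := by
    funext n
    rw [homogSum, Finset.sum_mul]
    refine Finset.sum_congr rfl fun kl hkl => ?_
    rw [← Finset.HasAntidiagonal.mem_antidiagonal.mp hkl, pow_add]
    ring
  have hs := (summable_norm_sum_mul_antidiagonal_of_summable_norm hxs hys).of_norm
  rw [key, ← tsum_geometric_of_norm_lt_one hx, ← tsum_geometric_of_norm_lt_one hy,
    tsum_mul_tsum_eq_tsum_sum_antidiagonal_of_summable_norm hxs hys]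
  exact hs.hasSum

lemma one_sub_ne_zero_of_norm_lt_one {z : ℂ} (hz : ‖z‖ < 1) : 1 - z ≠ 0 := by
  intro h
  rw [← sub_eq_zero.mp h] at hz
  simp at hz

lemma hasSum_homogSum_mul_homogSum_mul_pow {A B C D X : ℂ} (hCD : C ≠ D)
    (hAC : ‖A * (C * X)‖ < 1) (hBC : ‖B * (C * X)‖ < 1)
    (hAD : ‖A * (D * X)‖ < 1) (hBD : ‖B * (D * X)‖ < 1) (m : ℕ) :
    HasSum (fun j => homogSum A B j * homogSum C D (m + j) * X ^ j)
      ((C ^ (m + 1) * ((1 - A * (C * X))⁻¹ * (1 - B * (C * X))⁻¹) -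
        D ^ (m + 1) * ((1 - A * (D * X))⁻¹ * (1 - B * (D * X))⁻¹)) / (C - D)) := by
  have hs := (((hasSum_homogSum_mul_pow hAC hBC).mul_left (C ^ (m + 1))).sub
    ((hasSum_homogSum_mul_pow hAD hBD).mul_left (D ^ (m + 1)))).div_const (C - D)
  refine (congrArg (HasSum · _) (funext fun j => ?_)).mpr hs
  rw [eq_div_iff (sub_ne_zero.mpr hCD)]
  calc _ = homogSum A B j * X ^ j * (homogSum C D (m + j) * (C - D)) := by ring
    _ = _ := by rw [homogSum_mul_sub]; ring

/-- The ratio of the two generating functions in closed form. -/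
lemma tsum_homogSum_div_tsum_homogSum {A B C D X : ℂ} (hCD : C ≠ D) (hD : D ≠ 0)
    (hAC : ‖A * (C * X)‖ < 1) (hBC : ‖B * (C * X)‖ < 1)
    (hAD : ‖A * (D * X)‖ < 1) (hBD : ‖B * (D * X)‖ < 1) (m : ℕ) :
    (∑' j, homogSum A B j * homogSum C D (m + j) * X ^ j) /
        (∑' j, homogSum A B j * homogSum C D j * X ^ j) =
      D ^ m * (((1 - (C / D) ^ (m + 1)) - X * (A + B) * C * (1 - (C / D) ^ m) +
          X ^ 2 * (A * B) * (C ^ 2 - D ^ 2 * (C / D) ^ (m + 1))) /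
        ((1 - C / D) * (1 - X ^ 2 * (A * B * C * D)))) := by
  have h0 : (∑' j, homogSum A B j * homogSum C D j * X ^ j) =
      ((C ^ (0 + 1) * ((1 - A * (C * X))⁻¹ * (1 - B * (C * X))⁻¹) -
        D ^ (0 + 1) * ((1 - A * (D * X))⁻¹ * (1 - B * (D * X))⁻¹)) / (C - D)) := by
    simpa using (hasSum_homogSum_mul_homogSum_mul_pow hCD hAC hBC hAD hBD 0).tsum_eq
  rw [(hasSum_homogSum_mul_homogSum_mul_pow hCD hAC hBC hAD hBD m).tsum_eq, h0]
  have n1 := one_sub_ne_zero_of_norm_lt_one hAC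
  have n2 := one_sub_ne_zero_of_norm_lt_one hBC
  have n3 := one_sub_ne_zero_of_norm_lt_one hAD
  have n4 := one_sub_ne_zero_of_norm_lt_one hBD
  have n5 : C - D ≠ 0 := sub_ne_zero.mpr hCD
  have n6 : 1 - X ^ 2 * (A * B * C * D) ≠ 0 := by
    apply one_sub_ne_zero_of_norm_lt_one
    have : X ^ 2 * (A * B * C * D) = (A * (C * X)) * (B * (D * X)) := by ring
    rw [this, norm_mul]
    exact mul_lt_one_of_nonneg_of_lt_one_left (norm_nonneg _) hAC hBD.le
  have n7 : 1 - C / D ≠ 0 := by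
    rw [sub_ne_zero, ne_comm, Ne, div_eq_one_iff_eq hD]
    exact hCD
  have num : ∀ n : ℕ, (C ^ (n + 1) * ((1 - A * (C * X))⁻¹ * (1 - B * (C * X))⁻¹) -
        D ^ (n + 1) * ((1 - A * (D * X))⁻¹ * (1 - B * (D * X))⁻¹)) / (C - D) =
      (C ^ (n + 1) * ((1 - A * (D * X)) * (1 - B * (D * X))) -
        D ^ (n + 1) * ((1 - A * (C * X)) * (1 - B * (C * X)))) /
        ((C - D) * ((1 - A * (C * X)) * (1 - B * (C * X)) *
          ((1 - A * (D * X)) * (1 - B * (D * X))))) := by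
    intro n
    generalize 1 - A * (C * X) = a at *
    generalize 1 - B * (C * X) = b at *
    generalize 1 - A * (D * X) = a' at *
    generalize 1 - B * (D * X) = b' at *
    field_simp
  have num0 : C ^ (0 + 1) * ((1 - A * (D * X)) * (1 - B * (D * X))) -
        D ^ (0 + 1) * ((1 - A * (C * X)) * (1 - B * (C * X))) =
      (C - D) * (1 - X ^ 2 * (A * B * C * D)) := by ring
  rw [num, num, num0, div_div_div_cancel_right₀ (by positivity), ← mul_div_assoc,
    div_eq_div_iff (mul_ne_zero n5 n6) (mul_ne_zero n7 n6), div_pow, div_pow]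
  field_simp
  ring

lemma natCast_pow_cpow (p n : ℕ) (s : ℂ) : ((p ^ n : ℕ) : ℂ) ^ s = ((p : ℂ) ^ s) ^ n := by
  induction n with
  | zero => simp
  | succ n ih => rw [pow_succ, Nat.cast_mul, natCast_mul_natCast_cpow, ih, pow_succ]

lemma natCast_prod_cpow {ι : Type*} (t : Finset ι) (f : ι → ℕ) (s : ℂ) :
    ((∏ i ∈ t, f i : ℕ) : ℂ) ^ s = ∏ i ∈ t, (f i : ℂ) ^ s := by
  classical
  induction t using Finset.induction_on with
  | empty => simp
  | insert a t ha ih =>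
    rw [Finset.prod_insert ha, Finset.prod_insert ha, Nat.cast_mul, natCast_mul_natCast_cpow, ih]

lemma sigmaab_prime_pow {p : ℕ} (hp : p.Prime) (α β : ℂ) (n : ℕ) :
    sigmaab α β (p ^ n) = homogSum ((p : ℂ) ^ (-α)) ((p : ℂ) ^ (-β)) n := by
  rw [homogSum_comm, homogSum, Finset.Nat.sum_antidiagonal_eq_sum_range_succ
    (fun i j => ((p : ℂ) ^ (-β)) ^ i * ((p : ℂ) ^ (-α)) ^ j), sigmaab,
    Nat.sum_divisors_prime_pow hp]
  refine Finset.sum_congr rfl fun i hi => ?_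
  rw [Nat.pow_div (by simpa [Nat.lt_succ_iff] using hi) hp.pos, natCast_pow_cpow,
    natCast_pow_cpow, mul_comm]

lemma sigmaab_comm (α β : ℂ) (n : ℕ) : sigmaab α β n = sigmaab β α n := by
  unfold sigmaab
  rw [← Nat.sum_div_divisors]
  refine Finset.sum_congr rfl fun d hd => ?_
  rw [Nat.div_div_self (Nat.dvd_of_mem_divisors hd) (Nat.ne_zero_of_mem_divisors hd), mul_comm]

lemma sigmaab_eq_cpow_mul_sum (α γ : ℂ) (n : ℕ) :
    sigmaab γ (-α) n = (n : ℂ) ^ α * ∑ d ∈ n.divisors, (d : ℂ) ^ (-α - γ) := by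
  rw [sigmaab_comm, sigmaab, Finset.mul_sum]
  refine Finset.sum_congr rfl fun d hd => ?_
  have hd0 : (d : ℂ) ≠ 0 := by
    exact_mod_cast (Nat.pos_of_mem_divisors hd).ne'
  conv_rhs => rw [← Nat.div_mul_cancel (Nat.dvd_of_mem_divisors hd), Nat.cast_mul,
    natCast_mul_natCast_cpow]
  rw [mul_assoc, ← cpow_add _ _ hd0, neg_neg]
  congr 2
  ring

/-- The arithmetic function `n ↦ n ^ s`. -/
noncomputable def cpowArith (s : ℂ) : ArithmeticFunction ℂ := ⟨fun n => if n = 0 then 0 else (n : ℂ) ^ s, by simp⟩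

lemma cpowArith_isMultiplicative (s : ℂ) : (cpowArith s).IsMultiplicative := by
  refine ArithmeticFunction.IsMultiplicative.iff_ne_zero.mpr ⟨by simp [cpowArith], ?_⟩
  intro m n hm hn _
  simp [cpowArith, hm, hn, natCast_mul_natCast_cpow]

lemma sum_divisors_cpow_prod {ι : Type*} (t : Finset ι) (f : ι → ℕ) (s : ℂ)
    (hf : (t : Set ι).Pairwise (Function.onFun Nat.Coprime f)) :
    ∑ d ∈ (∏ i ∈ t, f i).divisors, (d : ℂ) ^ s = ∏ i ∈ t, ∑ d ∈ (f i).divisors, (d : ℂ) ^ s := by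
  have key : ∀ n : ℕ, ∑ d ∈ n.divisors, (d : ℂ) ^ s =
      (cpowArith s * (ArithmeticFunction.zeta : ArithmeticFunction ℂ)) n := by
    intro n
    rw [ArithmeticFunction.coe_mul_zeta_apply]
    refine Finset.sum_congr rfl fun d hd => ?_
    simp [cpowArith, (Nat.pos_of_mem_divisors hd).ne']
  simp only [key]
  exact ((cpowArith_isMultiplicative s).mul
    ArithmeticFunction.isMultiplicative_zeta.natCast).map_prod f t hf

lemma qPart_eq_prod {q n : ℕ} (hq : q ≠ 0) (hn : n ≠ 0) :
    qPart q n = ∏ p ∈ q.primeFactors, p ^ n.factorization p := by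
  unfold qPart
  refine Finset.prod_subset_one_on_sdiff ?_ ?_ fun _ _ => rfl
  · intro p hp
    simp only [Finset.mem_filter, Nat.mem_primeFactors] at hp ⊢
    exact ⟨hp.1.1, hp.2, hq⟩
  · intro p hp
    simp only [Finset.mem_sdiff, Finset.mem_filter, Nat.mem_primeFactors] at hp
    rw [Nat.factorization_eq_zero_of_not_dvd, pow_zero]
    exact fun hd => hp.2 ⟨⟨hp.1.1, hd, hn⟩, hp.1.2.1⟩

lemma qPart_mul_div {q n : ℕ} (hq : q ≠ 0) (hn : n ≠ 0) : qPart q (q * n) / q = qPart q n := by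
  have : qPart q (q * n) = q * qPart q n := by
    rw [qPart_eq_prod hq (mul_ne_zero hq hn), qPart_eq_prod hq hn, Nat.factorization_mul hq hn]
    simp only [Finsupp.add_apply, pow_add, Finset.prod_mul_distrib]
    congr 1
    exact Nat.prod_factorization_pow_eq_self hq
  rw [this, Nat.mul_div_cancel_left _ (Nat.pos_of_ne_zero hq)]

lemma qPart_of_coprime {q n : ℕ} (hqn : Nat.Coprime n q) : qPart q n = 1 := by
  unfold qPart
  refine Finset.prod_eq_one fun p hp => ?_
  simp only [Finset.mem_filter, Nat.mem_primeFactors] at hp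
  exact absurd (Nat.eq_one_of_dvd_coprimes hqn hp.1.2.1 hp.2) hp.1.1.ne_one

lemma norm_mul_natCast_cpow_lt_one {p : ℕ} (hp : p.Prime) {c s : ℂ} (hc : ‖c‖ ≤ 1)
    (hs : s.re < 0) : ‖c * (p : ℂ) ^ s‖ < 1 := by
  rw [norm_mul, norm_natCast_cpow_of_pos hp.pos]
  refine mul_lt_one_of_nonneg_of_lt_one_right hc (by positivity) ?_
  exact Real.rpow_lt_one_of_one_lt_of_neg (by exact_mod_cast hp.one_lt) hs

/-- The Euler factor of `B′` at a prime `p`, compared with that of `C₁₂`. -/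
lemma eulerFactor_eq {p : ℕ} (hp : p.Prime) {c α β γ δ : ℂ} (hc : ‖c‖ ≤ 1)
    (hα : |α.re| < 1 / 4) (hβ : |β.re| < 1 / 4) (hγ : |γ.re| < 1 / 4) (hδ : |δ.re| < 1 / 4)
    (h1 : (p : ℂ) ^ (α + γ) ≠ 1) (m : ℕ) :
    (∑' j : ℕ, c ^ j * sigmaab (-δ) β (p ^ j) * sigmaab γ (-α) (p ^ (m + j)) *
        (p : ℂ) ^ (-((j : ℂ) * (1 + 0)))) /
      (∑' j : ℕ, c ^ j * sigmaab (-δ) β (p ^ j) * sigmaab γ (-α) (p ^ j) *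
        (p : ℂ) ^ (-((j : ℂ) * (1 + 0)))) =
    ((p : ℂ) ^ α) ^ m *
    (((1 - (p : ℂ) ^ (-(((m : ℂ) + 1) * (α + γ + 2 * 0))))
      - (p : ℂ) ^ (-1 : ℂ) *
        (c * ((p : ℂ) ^ (δ - γ) + (p : ℂ) ^ (-β - γ - 2 * 0)) *
          (1 - (p : ℂ) ^ (-((m : ℂ) * (α + γ + 2 * 0)))))
      + (p : ℂ) ^ (-2 : ℂ) *
        (c ^ 2 * (p : ℂ) ^ (δ - β) *
          ((p : ℂ) ^ (-(2 * (γ + 0))) - (p : ℂ) ^ (2 * (α + 0)) *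
            (p : ℂ) ^ (-(((m : ℂ) + 1) * (α + γ + 2 * 0)))))) /
     ((1 - (p : ℂ) ^ (-α - γ - 2 * 0)) * (1 - c ^ 2 * (p : ℂ) ^ (-2 + α - β - γ + δ)))) := by
  have hp0 : (p : ℂ) ≠ 0 := by exact_mod_cast hp.ne_zero
  have hadd : ∀ x y : ℂ, (p : ℂ) ^ (x + y) = (p : ℂ) ^ x * (p : ℂ) ^ y :=
    fun x y => cpow_add _ _ hp0
  have hX : ∀ j : ℕ, (p : ℂ) ^ (-((j : ℂ) * (1 + 0))) = ((p : ℂ) ^ (-1 : ℂ)) ^ j := by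
    intro j
    rw [← cpow_nat_mul]
    congr 1
    ring
  have hCD : (p : ℂ) ^ (-γ) ≠ (p : ℂ) ^ α := by
    intro h
    apply h1
    rw [hadd, ← h, ← hadd, neg_add_cancel, cpow_zero]
  have hD : (p : ℂ) ^ α ≠ 0 := by simp [cpow_eq_zero_iff, hp0]
  have hnorm : ∀ a b : ℂ, a.re < 1 / 4 → b.re < 1 / 4 →
      ‖(p : ℂ) ^ a * ((p : ℂ) ^ b * (c * (p : ℂ) ^ (-1 : ℂ)))‖ < 1 := by
    intro a b ha hb
    have : (p : ℂ) ^ a * ((p : ℂ) ^ b * (c * (p : ℂ) ^ (-1 : ℂ))) = c * (p : ℂ) ^ (a + b + -1) := by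
      rw [hadd, hadd]
      ring
    rw [this]
    refine norm_mul_natCast_cpow_lt_one hp hc ?_
    simp only [add_re, neg_re, one_re]
    linarith
  rw [abs_lt] at hα hβ hγ hδ
  have hm := tsum_homogSum_div_tsum_homogSum (A := (p : ℂ) ^ δ) (B := (p : ℂ) ^ (-β)) hCD hD
    (hnorm _ _ hδ.2 (by simp only [neg_re]; linarith))
    (hnorm _ _ (by simp only [neg_re]; linarith) (by simp only [neg_re]; linarith))
    (hnorm _ _ hδ.2 hα.2) (hnorm _ _ (by simp only [neg_re]; linarith) hα.2) m
  have hterm : ∀ n j : ℕ, c ^ j * sigmaab (-δ) β (p ^ j) * sigmaab γ (-α) (p ^ n) *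
      (p : ℂ) ^ (-((j : ℂ) * (1 + 0))) =
      homogSum ((p : ℂ) ^ δ) ((p : ℂ) ^ (-β)) j * homogSum ((p : ℂ) ^ (-γ)) ((p : ℂ) ^ α) n *
        (c * (p : ℂ) ^ (-1 : ℂ)) ^ j := by
    intro n j
    rw [hX, sigmaab_prime_pow hp, sigmaab_prime_pow hp, neg_neg, neg_neg, mul_pow]
    ring
  simp only [hterm, hm]
  have hdiv : (p : ℂ) ^ (-α - γ - 2 * 0) = (p : ℂ) ^ (-γ) / (p : ℂ) ^ α := by
    rw [← cpow_sub _ _ hp0]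
    congr 1
    ring
  have hdivpow : ∀ n : ℂ, (p : ℂ) ^ (-(n * (α + γ + 2 * 0))) = (p : ℂ) ^ (n * (-α - γ - 2 * 0)) := by
    intro n
    congr 1
    ring
  have e1 : (p : ℂ) ^ (δ - γ) = (p : ℂ) ^ δ * (p : ℂ) ^ (-γ) := by rw [← hadd, sub_eq_add_neg]
  have e2 : (p : ℂ) ^ (-β - γ - 2 * 0) = (p : ℂ) ^ (-β) * (p : ℂ) ^ (-γ) := by
    rw [← hadd]
    congr 1
    ring
  have e3 : (p : ℂ) ^ (δ - β) = (p : ℂ) ^ δ * (p : ℂ) ^ (-β) := by rw [← hadd, sub_eq_add_neg]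
  have e4 : (p : ℂ) ^ (-(2 * (γ + 0))) = ((p : ℂ) ^ (-γ)) ^ 2 := by
    rw [← cpow_nat_mul]
    congr 1
    push_cast
    ring
  have e5 : (p : ℂ) ^ (2 * (α + 0)) = ((p : ℂ) ^ α) ^ 2 := by
    rw [← cpow_nat_mul]
    congr 1
    push_cast
    ring
  have e6 : (p : ℂ) ^ (-2 : ℂ) = ((p : ℂ) ^ (-1 : ℂ)) ^ 2 := by
    rw [← cpow_nat_mul]
    congr 1
    push_cast
    ring
  have e7 : (p : ℂ) ^ (-2 + α - β - γ + δ) =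
      ((p : ℂ) ^ (-1 : ℂ)) ^ 2 * ((p : ℂ) ^ δ * (p : ℂ) ^ (-β) * (p : ℂ) ^ (-γ) * (p : ℂ) ^ α) := by
    rw [← e6, ← hadd, ← hadd, ← hadd, ← hadd]
    congr 1
    ring
  rw [hdivpow, hdivpow, ← Nat.cast_add_one, cpow_nat_mul, cpow_nat_mul, hdiv, e1, e2, e3, e4, e5, e7,
    e6]
  congr 2 <;> ring

lemma B'h_zero_eq {q : ℕ} [NeZero q] (χ : DirichletCharacter ℂ q) {n : ℕ} (hn : n ≠ 0)
    {α β γ δ : ℂ}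
    (hα : |α.re| < 1 / 4) (hβ : |β.re| < 1 / 4) (hγ : |γ.re| < 1 / 4) (hδ : |δ.re| < 1 / 4)
    (h1 : ∀ p : ℕ, p.Prime → p ∣ n → ¬ p ∣ q → (p : ℂ) ^ (α + γ) ≠ 1) :
    B'h χ (-δ) β γ (-α) n 0 =
      (n : ℂ) ^ α * (∑ m ∈ (qPart q n).divisors, (m : ℂ) ^ (-α - γ)) * C12h χ α β γ δ n 0 := by
  have hnα : (n : ℂ) ^ α = ∏ p ∈ n.primeFactors, ((p : ℂ) ^ α) ^ n.factorization p := by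
    conv_lhs => rw [← Nat.prod_factorization_pow_eq_self hn]
    rw [Finsupp.prod, natCast_prod_cpow, Nat.support_factorization]
    exact Finset.prod_congr rfl fun p _ => natCast_pow_cpow p _ α
  have hsum : (∑ m ∈ (qPart q n).divisors, (m : ℂ) ^ (-α - γ)) =
      ∏ p ∈ n.primeFactors.filter (· ∣ q),
        ∑ d ∈ (p ^ n.factorization p).divisors, (d : ℂ) ^ (-α - γ) := by
    rw [qPart, sum_divisors_cpow_prod]
    intro a ha b hb hab
    simp only [Finset.coe_filter, Nat.mem_primeFactors, Set.mem_ofPred_eq] at ha hb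
    exact Nat.coprime_pow_primes _ _ ha.1.1 hb.1.1 hab
  have hq : ∀ p ∈ n.primeFactors.filter (· ∣ q),
      (∑' j : ℕ, χ (p : ZMod q) ^ j * sigmaab (-δ) β (p ^ j) *
          sigmaab γ (-α) (p ^ (n.factorization p + j)) * (p : ℂ) ^ (-((j : ℂ) * (1 + 0)))) /
        (∑' j : ℕ, χ (p : ZMod q) ^ j * sigmaab (-δ) β (p ^ j) * sigmaab γ (-α) (p ^ j) *
          (p : ℂ) ^ (-((j : ℂ) * (1 + 0)))) =
      ((p : ℂ) ^ α) ^ n.factorization p *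
        ∑ d ∈ (p ^ n.factorization p).divisors, (d : ℂ) ^ (-α - γ) := by
    intro p hp
    simp only [Finset.mem_filter, Nat.mem_primeFactors] at hp
    have hχp : χ (p : ZMod q) = 0 := by
      refine χ.map_nonunit ?_
      rw [ZMod.isUnit_iff_coprime, hp.1.1.coprime_iff_not_dvd, not_not]
      exact hp.2
    rw [hχp, tsum_eq_single 0 (fun j hj => by simp [hj]),
      tsum_eq_single 0 (fun j hj => by simp [hj])]
    simp only [← natCast_pow_cpow, ← sigmaab_eq_cpow_mul_sum]
    simp [sigmaab]
  have hnq : ∀ p ∈ n.primeFactors.filter (fun p => ¬ p ∣ q), p.Prime ∧ (p : ℂ) ^ (α + γ) ≠ 1 := by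
    intro p hp
    simp only [Finset.mem_filter, Nat.mem_primeFactors] at hp
    exact ⟨hp.1.1, h1 p hp.1.1 hp.1.2.1 hp.2⟩
  rw [hnα, hsum, C12h, B'h, ← Finset.prod_filter_mul_prod_filter_not n.primeFactors (· ∣ q),
    ← Finset.prod_filter_mul_prod_filter_not n.primeFactors (· ∣ q)
      (fun p : ℕ => ((p : ℂ) ^ α) ^ n.factorization p),
    Finset.prod_congr rfl hq, Finset.prod_congr rfl fun p hp =>
      eulerFactor_eq (hnq p hp).1 (χ.norm_le_one p) hα hβ hγ hδ (hnq p hp).2 (n.factorization p),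
    Finset.prod_mul_distrib, Finset.prod_mul_distrib]
  ring

/-- relating `C₁₂` at `s = 0` to `B′` (Lemma 10 of the paper). -/
theorem statement_19 (q : ℕ) [NeZero q] (χ : DirichletCharacter ℂ q) (hχ : χ.IsPrimitive)
    (h k : ℕ) (hh : 0 < h) (hk : 0 < k) (hhk : Nat.Coprime h k) (hqh : q ∣ h)
    (α β γ δ : ℂ)
    (hα : |α.re| < 1 / 4) (hβ : |β.re| < 1 / 4) (hγ : |γ.re| < 1 / 4) (hδ : |δ.re| < 1 / 4)
    (h1 : ∀ p : ℕ, p.Prime → p ∣ h → ¬ p ∣ q → (p : ℂ) ^ (α + γ) ≠ 1)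
    (h2 : ∀ p : ℕ, p.Prime → p ∣ k → (p : ℂ) ^ (β + δ) ≠ 1) :
    (q : ℂ) ^ (-α) * (∑ m ∈ (qPart q h / q).divisors, (m : ℂ) ^ (-α - γ)) *
        (h : ℂ) ^ α * (k : ℂ) ^ δ * C12full χ α β γ δ h k 0
      = B'full χ (-δ) β γ (-α) (h / q) k 0 := by
  have hq0 : q ≠ 0 := NeZero.ne q
  obtain ⟨n, rfl⟩ := hqh
  have hn : n ≠ 0 := by
    rintro rfl
    simp at hh
  have hkq : Nat.Coprime k q := (Nat.Coprime.coprime_mul_right hhk).symm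
  have hC : C12h χ α β γ δ (q * n) 0 = C12h χ α β γ δ n 0 := by
    unfold C12h
    refine Finset.prod_congr ?_ fun p hp => ?_
    · ext p
      simp only [Finset.mem_filter, Nat.mem_primeFactors]
      constructor
      · rintro ⟨⟨hp, hpd, -⟩, hpq⟩
        exact ⟨⟨hp, (hp.dvd_mul.mp hpd).resolve_left hpq, hn⟩, hpq⟩
      · rintro ⟨⟨hp, hpd, -⟩, hpq⟩
        exact ⟨⟨hp, hpd.mul_left q, mul_ne_zero hq0 hn⟩, hpq⟩
    · have hpn : (q * n).factorization p = n.factorization p := by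
        rw [Nat.factorization_mul hq0 hn, Finsupp.add_apply,
          Nat.factorization_eq_zero_of_not_dvd (Finset.mem_filter.mp hp).2, zero_add]
      rw [hpn]
  have hBk : B'h χ γ (-α) (-δ) β k 0 = B'h χ (-α) γ β (-δ) k 0 := by
    unfold B'h
    simp only [sigmaab_comm γ (-α), sigmaab_comm (-δ) β]
  have hBk' := B'h_zero_eq χ hk.ne' hδ hγ hβ hα fun p hp hpk _ => add_comm β δ ▸ h2 p hp hpk
  rw [qPart_of_coprime hkq, Nat.divisors_one, Finset.sum_singleton, Nat.cast_one, one_cpow,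
    mul_one] at hBk'
  rw [B'full, C12full, hC, qPart_mul_div hq0 hn, Nat.mul_div_cancel_left _ (NeZero.pos q), hBk,
    hBk', B'h_zero_eq χ hn hα hβ hγ hδ fun p hp hpn => h1 p hp (hpn.mul_left q), Nat.cast_mul,
    natCast_mul_natCast_cpow]
  have hqα : (q : ℂ) ^ (-α) * (q : ℂ) ^ α = 1 := by
    rw [← cpow_add _ _ (Nat.cast_ne_zero.mpr hq0), neg_add_cancel, cpow_zero]
  linear_combination (n : ℂ) ^ α * (∑ m ∈ (qPart q n).divisors, (m : ℂ) ^ (-α - γ)) *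
    C12h χ α β γ δ n 0 * ((k : ℂ) ^ δ * C12h χ δ γ β α k 0) * hqα
end
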